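/- Let b, c, k₁, σ > 0 with b·σ·√(2π) > k₁. Then for every μ ∈ ℝ there is a unique θ̂(μ) ∈ ℝ satisfying b·θ̂(μ) + c + k₁ = k₁·Φ((θ̂(μ) − μ)/σ), and the function μ ↦ θ̂(μ) is strictly decreasing: if μ₁ < μ₂ then θ̂(μ₂) < θ̂(μ₁). -/

import Mathlib

open Real MeasureTheory

/-- The standard normal cumulative distribution function
`Φ(z) = (1/√(2π)) ∫_{−∞}^{z} exp(−t²/2) dt`. -/
noncomputable def stdNormalCDF (z : ℝ) : ℝ :=
  (Real.sqrt (2 * Real.pi))⁻¹ * ∫ t in Set.Iic z, Real.exp (-t ^ 2 / 2)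

theorem integrable_exp_neg_sq_div_two : Integrable fun t : ℝ => Real.exp (-t ^ 2 / 2) := by
  convert integrable_exp_neg_mul_sq (b := 1 / 2) (by norm_num) using 3
  ring

theorem integral_exp_neg_sq_div_two : ∫ t : ℝ, Real.exp (-t ^ 2 / 2) = Real.sqrt (2 * Real.pi) := by
  convert integral_gaussian (1 / 2) using 2
  · ext t
    congr 1
    ring
  · ring

theorem stdNormalCDF_nonneg (z : ℝ) : 0 ≤ stdNormalCDF z :=
  mul_nonneg (by positivity) (integral_nonneg fun _ => (Real.exp_pos _).le)

theorem stdNormalCDF_le_one (z : ℝ) : stdNormalCDF z ≤ 1 := by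
  have hpos : 0 < Real.sqrt (2 * Real.pi) := by positivity
  rw [stdNormalCDF, inv_mul_le_iff₀ hpos, mul_one, ← integral_exp_neg_sq_div_two]
  exact setIntegral_le_integral integrable_exp_neg_sq_div_two
    (Filter.Eventually.of_forall fun _ => (Real.exp_pos _).le)

theorem stdNormalCDF_sub (x y : ℝ) : stdNormalCDF y - stdNormalCDF x =
    (Real.sqrt (2 * Real.pi))⁻¹ * ∫ t in x..y, Real.exp (-t ^ 2 / 2) := by
  rw [stdNormalCDF, stdNormalCDF, ← mul_sub, intervalIntegral.integral_Iic_sub_Iic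
    integrable_exp_neg_sq_div_two.integrableOn integrable_exp_neg_sq_div_two.integrableOn]

theorem stdNormalCDF_strictMono : StrictMono stdNormalCDF := by
  intro x y hxy
  have hint : 0 < ∫ t in x..y, Real.exp (-t ^ 2 / 2) :=
    intervalIntegral.intervalIntegral_pos_of_pos
      integrable_exp_neg_sq_div_two.intervalIntegrable (fun _ => Real.exp_pos _) hxy
  rw [← sub_pos, stdNormalCDF_sub]
  positivity

theorem stdNormalCDF_sub_le {x y : ℝ} (hxy : x ≤ y) :
    stdNormalCDF y - stdNormalCDF x ≤ (Real.sqrt (2 * Real.pi))⁻¹ * (y - x) := by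
  rw [stdNormalCDF_sub]
  gcongr
  have h := intervalIntegral.integral_mono_on hxy
    integrable_exp_neg_sq_div_two.intervalIntegrable
    (intervalIntegrable_const (c := (1 : ℝ)))
    (fun t _ => Real.exp_le_one_iff.2 (by nlinarith [sq_nonneg t]))
  simpa using h

theorem continuous_stdNormalCDF : Continuous stdNormalCDF := by
  have h : stdNormalCDF = fun z => stdNormalCDF 0 +
      (Real.sqrt (2 * Real.pi))⁻¹ * ∫ t in (0 : ℝ)..z, Real.exp (-t ^ 2 / 2) := by
    ext z
    rw [← stdNormalCDF_sub]
    ring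
  rw [h]
  exact continuous_const.add (continuous_const.mul (intervalIntegral.continuous_primitive
    (fun _ _ => integrable_exp_neg_sq_div_two.intervalIntegrable) 0))

/-- A slope steeper than the maximal slope of `k₁ · Φ` dominates its increments. -/
theorem mul_stdNormalCDF_sub_lt {a k x y : ℝ} (hk : 0 < k)
    (ha : k < a * Real.sqrt (2 * Real.pi)) (hxy : x < y) :
    k * (stdNormalCDF y - stdNormalCDF x) < a * (y - x) := by
  have hpos : 0 < Real.sqrt (2 * Real.pi) := by positivity
  calc k * (stdNormalCDF y - stdNormalCDF x)
      ≤ k * ((Real.sqrt (2 * Real.pi))⁻¹ * (y - x)) := by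
        gcongr
        exact stdNormalCDF_sub_le hxy.le
    _ = k / Real.sqrt (2 * Real.pi) * (y - x) := by ring
    _ < a * (y - x) :=
        mul_lt_mul_of_pos_right ((div_lt_iff₀ hpos).2 ha) (sub_pos.2 hxy)

theorem exists_threshold {b c k₁ : ℝ} (hb : 0 < b) (hk : 0 < k₁) (σ μ : ℝ) :
    ∃ θ : ℝ, b * θ + c + k₁ = k₁ * stdNormalCDF ((θ - μ) / σ) := by
  have hcont : Continuous fun θ : ℝ => b * θ + c + k₁ - k₁ * stdNormalCDF ((θ - μ) / σ) := by
    have := continuous_stdNormalCDF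
    fun_prop
  have hle : -(c + k₁) / b ≤ -c / b := by
    gcongr
    linarith
  obtain ⟨θ, -, hθ⟩ := intermediate_value_Icc hle hcont.continuousOn (show (0 : ℝ) ∈ _ by
    constructor
    · have h := mul_nonneg hk.le (stdNormalCDF_nonneg ((-(c + k₁) / b - μ) / σ))
      have e : b * (-(c + k₁) / b) = -(c + k₁) := by field_simp
      linarith
    · have h := mul_le_mul_of_nonneg_left (stdNormalCDF_le_one ((-c / b - μ) / σ)) hk.le
      have e : b * (-c / b) = -c := by field_simp
      linarith)
  exact ⟨θ, sub_eq_zero.1 hθ⟩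

theorem threshold_lt_of_lt {b c k₁ σ μ₁ μ₂ θ₁ θ₂ : ℝ} (hb : 0 < b) (hk : 0 < k₁) (hσ : 0 < σ)
    (hslope : k₁ < b * σ * Real.sqrt (2 * Real.pi))
    (h₁ : b * θ₁ + c + k₁ = k₁ * stdNormalCDF ((θ₁ - μ₁) / σ))
    (h₂ : b * θ₂ + c + k₁ = k₁ * stdNormalCDF ((θ₂ - μ₂) / σ))
    (hμ : μ₁ < μ₂) : θ₂ < θ₁ := by
  rcases lt_or_ge ((θ₁ - μ₁) / σ) ((θ₂ - μ₂) / σ) with hz | hz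
  · have h := mul_stdNormalCDF_sub_lt hk hslope hz
    have e : b * σ * ((θ₂ - μ₂) / σ - (θ₁ - μ₁) / σ) = b * (θ₂ - θ₁) - b * (μ₂ - μ₁) := by
      field_simp
      ring
    have := mul_pos hb (sub_pos.2 hμ)
    linarith
  · have h := mul_le_mul_of_nonneg_left (stdNormalCDF_strictMono.monotone hz) hk.le
    have hle : θ₂ ≤ θ₁ := le_of_mul_le_mul_left (by linarith) hb
    refine hle.lt_of_ne ?_
    rintro rfl
    have hlt : (θ₂ - μ₂) / σ < (θ₂ - μ₁) / σ := by gcongr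
    have := mul_lt_mul_of_pos_left (stdNormalCDF_strictMono hlt) hk
    linarith

theorem threshold_le {b c k₁ σ μ θ₁ θ₂ : ℝ} (hk : 0 < k₁) (hσ : 0 < σ)
    (hslope : k₁ < b * σ * Real.sqrt (2 * Real.pi))
    (h₁ : b * θ₁ + c + k₁ = k₁ * stdNormalCDF ((θ₁ - μ) / σ))
    (h₂ : b * θ₂ + c + k₁ = k₁ * stdNormalCDF ((θ₂ - μ) / σ)) : θ₂ ≤ θ₁ := by
  by_contra! hlt
  have hz : (θ₁ - μ) / σ < (θ₂ - μ) / σ := by gcongr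
  have h := mul_stdNormalCDF_sub_lt hk hslope hz
  have e : b * σ * ((θ₂ - μ) / σ - (θ₁ - μ) / σ) = b * (θ₂ - θ₁) := by
    field_simp
    ring
  linarith

/-- In the unique-equilibrium case `b·σ·√(2π) > k₁`, for every interim belief
`μ` there is a unique protest threshold `θ̂(μ)` solving
`b·θ̂ + c + k₁ = k₁·Φ((θ̂ − μ)/σ)`, and `μ ↦ θ̂(μ)` is strictly decreasing. -/
theorem stmt8 (b c k₁ σ : ℝ) (hb : 0 < b) (hc : 0 < c) (hk : 0 < k₁) (hσ : 0 < σ)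
    (hslope : b * σ * Real.sqrt (2 * Real.pi) > k₁) :
    ∃ f : ℝ → ℝ,
      (∀ μ : ℝ, (b * f μ + c + k₁ = k₁ * stdNormalCDF ((f μ - μ) / σ)) ∧
        ∀ θ : ℝ, b * θ + c + k₁ = k₁ * stdNormalCDF ((θ - μ) / σ) → θ = f μ) ∧
      StrictAnti f := by
  choose f hf using exists_threshold (c := c) hb hk σ
  exact ⟨f, fun μ => ⟨hf μ, fun θ hθ => le_antisymm (threshold_le hk hσ hslope (hf μ) hθ)
    (threshold_le hk hσ hslope hθ (hf μ))⟩,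
    fun μ₁ μ₂ hμ => threshold_lt_of_lt hb hk hσ hslope (hf μ₁) (hf μ₂) hμ⟩
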